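/- Let {X_n}_{n≥1} be a two-state correlated random walk on {1,-1} with parameters 0<p,q<1 and p≠q, started from the stationary distribution, and let S_n = X_1+···+X_n. Then with λ = q/p and a = (1/2)·[log_{q/p}((1-p)/(1-q)) - 1], the process M_n = λ^{S_n + a·X_n} is a martingale with respect to the filtration F_n = σ(X_1,...,X_n); equivalently, λ and a solve the system p·λ + (1-p)·λ^{-1-2a} = 1 and (1-q)·λ^{1+2a} + q·λ^{-1} = 1. -/

import Mathlib

open MeasureTheory ProbabilityTheory Set

noncomputable section

variable {Ω : Type*} [MeasurableSpace Ω]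

/-- The σ-algebra `σ(X_1, …, X_n)` generated by the first `n` steps of the process. -/
def sigmaUpTo (X : ℕ → Ω → ℝ) (n : ℕ) : MeasurableSpace Ω :=
  ⨆ i ∈ Finset.Icc 1 n, MeasurableSpace.comap (X i) inferInstance

/-- The transition kernel of a two-state correlated random walk on `{1, -1}`:
from state `1` go to `1` with probability `p`; from state `-1` go to `-1`
with probability `q`. -/
def crwKernel (p q : ℝ) (i j : ℝ) : ℝ :=
  if i = 1 then (if j = 1 then p else 1 - p)
  else (if j = -1 then q else 1 - q)

/-- `X` is a two-state correlated random walk on `{1, -1}` with parameters `p, q`,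
started from the stationary distribution `((1-q)/(2-p-q), (1-p)/(2-p-q))`:
each `X n` (for `n ≥ 1`) is measurable with values in `{1, -1}`, the initial
distribution is stationary, and the Markov property with the prescribed
time-homogeneous transition probabilities holds, conditionally on
`F n = σ(X_1, …, X_n)`. -/
def IsCRW (μ : Measure Ω) (X : ℕ → Ω → ℝ) (p q : ℝ) : Prop :=
  (∀ i, 1 ≤ i → Measurable (X i)) ∧
  (∀ n, 1 ≤ n → ∀ ω, X n ω = 1 ∨ X n ω = -1) ∧
  (μ {ω | X 1 ω = 1} = ENNReal.ofReal ((1 - q) / (2 - p - q))) ∧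
  (∀ n, 1 ≤ n → ∀ i ∈ ({1, -1} : Set ℝ), ∀ j ∈ ({1, -1} : Set ℝ),
    ∀ E : Set Ω, MeasurableSet[sigmaUpTo X n] E →
      μ (E ∩ {ω | X n ω = i ∧ X (n + 1) ω = j})
        = ENNReal.ofReal (crwKernel p q i j) * μ (E ∩ {ω | X n ω = i}))

/-- The natural filtration `F_{k+1} = σ(X_1, …, X_{k+1})`, shifted so that the
index `k : ℕ` corresponds to time `k + 1` (processes in the paper start at time 1). -/
def crwFiltration (X : ℕ → Ω → ℝ) (hX : ∀ i, 1 ≤ i → Measurable (X i)) :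
    Filtration ℕ (inferInstance : MeasurableSpace Ω) where
  seq k := sigmaUpTo X (k + 1)
  mono' a b hab := by
    refine biSup_mono fun i hi => ?_
    simp only [Finset.mem_Icc] at *
    omega
  le' k := iSup₂_le fun i hi => (hX i (Finset.mem_Icc.mp hi).1).comap_le

theorem rpow_logb_ratio_system {p q l a : ℝ}
    (hp0 : 0 < p) (hp1 : p < 1) (hq0 : 0 < q) (hq1 : q < 1) (hpq : p ≠ q)
    (hl : l = q / p)
    (ha : a = (1 / 2) * (Real.logb (q / p) ((1 - p) / (1 - q)) - 1)) :
    p * l + (1 - p) * l ^ (-1 - 2 * a) = 1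
    ∧ (1 - q) * l ^ (1 + 2 * a) + q * l ^ (-1 : ℝ) = 1 := by
  have hl0 : 0 < l := hl ▸ div_pos hq0 hp0
  have hl1 : l ≠ 1 := by
    rw [hl, Ne, div_eq_one_iff_eq hp0.ne']
    exact hpq.symm
  have h1p : 0 < 1 - p := sub_pos.2 hp1
  have h1q : 0 < 1 - q := sub_pos.2 hq1
  have key : l ^ (1 + 2 * a) = (1 - p) / (1 - q) := by
    have h : 1 + 2 * a = Real.logb l ((1 - p) / (1 - q)) := by rw [ha, hl]; ring
    rw [h, Real.rpow_logb hl0 hl1 (div_pos h1p h1q)]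
  have key' : l ^ (-1 - 2 * a) = (1 - q) / (1 - p) := by
    rw [show -1 - 2 * a = -(1 + 2 * a) by ring, Real.rpow_neg hl0.le, key, inv_div]
  rw [key, key', Real.rpow_neg_one, hl]
  constructor <;> field_simp <;> ring

theorem measurable_sigmaUpTo {α : Type*} {X : ℕ → α → ℝ} {n i : ℕ} (hi : 1 ≤ i) (hin : i ≤ n) :
    Measurable[sigmaUpTo X n] (X i) :=
  Measurable.of_comap_le (le_iSup₂_of_le i (Finset.mem_Icc.2 ⟨hi, hin⟩) le_rfl)

theorem sigmaUpTo_le {X : ℕ → Ω → ℝ} (hX : ∀ i, 1 ≤ i → Measurable (X i)) (n : ℕ) :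
    sigmaUpTo X n ≤ (inferInstance : MeasurableSpace Ω) :=
  iSup₂_le fun i hi => (hX i (Finset.mem_Icc.mp hi).1).comap_le

/-- The function equal to `r i j` on the event `{X n = i, X (n + 1) = j}`. -/
def stepFactor (X : ℕ → Ω → ℝ) (r : ℝ → ℝ → ℝ) (n : ℕ) (ω : Ω) : ℝ :=
  ∑ i ∈ ({1, -1} : Finset ℝ), ∑ j ∈ ({1, -1} : Finset ℝ),
    {ω | X n ω = i ∧ X (n + 1) ω = j}.indicator (fun _ => r i j) ω

theorem IsCRW.stepFactor_eq {μ : Measure Ω} {X : ℕ → Ω → ℝ} {p q : ℝ} (hX : IsCRW μ X p q)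
    (r : ℝ → ℝ → ℝ) {n : ℕ} (hn : 1 ≤ n) (ω : Ω) :
    stepFactor X r n ω = r (X n ω) (X (n + 1) ω) := by
  have hne : (1 : ℝ) ≠ -1 := by norm_num
  rcases hX.2.1 n hn ω with h | h <;> rcases hX.2.1 (n + 1) (by omega) ω with h' | h' <;>
    simp [stepFactor, Set.indicator, Finset.sum_pair hne, h, h', hne, hne.symm]

theorem IsCRW.measurableSet_step {μ : Measure Ω} {X : ℕ → Ω → ℝ} {p q : ℝ}
    (hX : IsCRW μ X p q) {n : ℕ} (hn : 1 ≤ n) (i j : ℝ) :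
    MeasurableSet {ω | X n ω = i ∧ X (n + 1) ω = j} :=
  (hX.1 n hn (measurableSet_singleton i)).inter
    (hX.1 (n + 1) (by omega) (measurableSet_singleton j))

theorem IsCRW.integrable_stepFactor {μ : Measure Ω} [IsProbabilityMeasure μ]
    {X : ℕ → Ω → ℝ} {p q : ℝ} (hX : IsCRW μ X p q) (r : ℝ → ℝ → ℝ) {n : ℕ} (hn : 1 ≤ n) :
    Integrable (stepFactor X r n) μ :=
  integrable_finsetSum _ fun i _ => integrable_finsetSum _ fun j _ =>
    (integrable_const (r i j)).indicator (hX.measurableSet_step hn i j)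

theorem norm_stepFactor_le {α : Type*} (X : ℕ → α → ℝ) (r : ℝ → ℝ → ℝ) (n : ℕ) (ω : α) :
    ‖stepFactor X r n ω‖ ≤
      ∑ i ∈ ({1, -1} : Finset ℝ), ∑ j ∈ ({1, -1} : Finset ℝ), ‖r i j‖ :=
  norm_sum_le_of_le _ fun _ _ => norm_sum_le_of_le _ fun _ _ => norm_indicator_le_norm_self _ _

theorem crwKernel_nonneg {p q : ℝ} (hp0 : 0 < p) (hp1 : p < 1) (hq0 : 0 < q) (hq1 : q < 1)
    (i j : ℝ) : 0 ≤ crwKernel p q i j := by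
  unfold crwKernel
  split_ifs <;> linarith

theorem IsCRW.setIntegral_stepFactor {μ : Measure Ω} [IsProbabilityMeasure μ]
    {X : ℕ → Ω → ℝ} {p q : ℝ} (hX : IsCRW μ X p q)
    (hp0 : 0 < p) (hp1 : p < 1) (hq0 : 0 < q) (hq1 : q < 1) {r : ℝ → ℝ → ℝ}
    (hr : ∀ i ∈ ({1, -1} : Finset ℝ),
      ∑ j ∈ ({1, -1} : Finset ℝ), crwKernel p q i j * r i j = 1)
    {n : ℕ} (hn : 1 ≤ n) {E : Set Ω} (hE : MeasurableSet[sigmaUpTo X n] E) :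
    ∫ ω in E, stepFactor X r n ω ∂μ = μ.real E := by
  have hE' : MeasurableSet E := sigmaUpTo_le hX.1 n E hE
  have hint : ∀ i j, Integrable
      ({ω | X n ω = i ∧ X (n + 1) ω = j}.indicator fun _ => r i j) (μ.restrict E) :=
    fun i j => (integrable_const (r i j)).indicator (hX.measurableSet_step hn i j)
  have hstep : ∀ i ∈ ({1, -1} : Finset ℝ), ∀ j ∈ ({1, -1} : Finset ℝ),
      ∫ ω in E, {ω | X n ω = i ∧ X (n + 1) ω = j}.indicator (fun _ => r i j) ω ∂μ
        = μ.real (E ∩ {ω | X n ω = i}) * (crwKernel p q i j * r i j) := by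
    intro i hi j hj
    rw [integral_indicator_const _ (hX.measurableSet_step hn i j), measureReal_def,
      Measure.restrict_apply (hX.measurableSet_step hn i j), Set.inter_comm,
      hX.2.2.2 n hn i (by simpa using hi) j (by simpa using hj) E hE, ENNReal.toReal_mul,
      ENNReal.toReal_ofReal (crwKernel_nonneg hp0 hp1 hq0 hq1 i j), measureReal_def, smul_eq_mul]
    ring
  have hsplit : E ∩ {ω | X n ω = -1} = E \ {ω | X n ω = 1} := by
    ext ω
    rcases hX.2.1 n hn ω with h | h <;> norm_num [h]
  calc ∫ ω in E, stepFactor X r n ω ∂μ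
      = ∑ i ∈ ({1, -1} : Finset ℝ), μ.real (E ∩ {ω | X n ω = i}) *
          ∑ j ∈ ({1, -1} : Finset ℝ), crwKernel p q i j * r i j := by
        unfold stepFactor
        rw [integral_finsetSum _ fun i _ => integrable_finsetSum _ fun j _ => hint i j]
        refine Finset.sum_congr rfl fun i hi => ?_
        rw [integral_finsetSum _ fun j _ => hint i j, Finset.mul_sum]
        exact Finset.sum_congr rfl fun j hj => hstep i hi j hj
    _ = ∑ i ∈ ({1, -1} : Finset ℝ), μ.real (E ∩ {ω | X n ω = i}) :=
        Finset.sum_congr rfl fun i hi => by rw [hr i hi, mul_one]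
    _ = μ.real E := by
        rw [Finset.sum_pair (by norm_num), hsplit]
        exact measureReal_inter_add_sdiff (hX.1 n hn (measurableSet_singleton 1))

theorem IsCRW.condExp_stepFactor {μ : Measure Ω} [IsProbabilityMeasure μ]
    {X : ℕ → Ω → ℝ} {p q : ℝ} (hX : IsCRW μ X p q)
    (hp0 : 0 < p) (hp1 : p < 1) (hq0 : 0 < q) (hq1 : q < 1) {r : ℝ → ℝ → ℝ}
    (hr : ∀ i ∈ ({1, -1} : Finset ℝ),
      ∑ j ∈ ({1, -1} : Finset ℝ), crwKernel p q i j * r i j = 1)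
    {n : ℕ} (hn : 1 ≤ n) :
    (fun _ => (1 : ℝ)) =ᵐ[μ] μ[stepFactor X r n|sigmaUpTo X n] := by
  refine ae_eq_condExp_of_forall_setIntegral_eq (sigmaUpTo_le hX.1 n)
    (hX.integrable_stepFactor r hn) (fun _ _ _ => (integrable_const _).integrableOn)
    (fun E hE _ => ?_) aestronglyMeasurable_const
  rw [hX.setIntegral_stepFactor hp0 hp1 hq0 hq1 hr hn hE]
  simp

/-- For an asymmetric two-state CRW (`p ≠ q`), with `λ = q/p` and
`a = (1/2)·[log_{q/p}((1-p)/(1-q)) - 1]`, the process `M_n = λ^(S_n + a·X_n)` is a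
martingale with respect to the natural filtration; equivalently, `λ` and `a` solve
the system `p·λ + (1-p)·λ^(-1-2a) = 1` and `(1-q)·λ^(1+2a) + q·λ⁻¹ = 1`. -/
theorem crw_exponential_martingale
    (μ : Measure Ω) [IsProbabilityMeasure μ] (X : ℕ → Ω → ℝ) (p q : ℝ)
    (hp0 : 0 < p) (hp1 : p < 1) (hq0 : 0 < q) (hq1 : q < 1) (hpq : p ≠ q)
    (hX : IsCRW μ X p q)
    (S : ℕ → Ω → ℝ) (hS : ∀ n ω, S n ω = ∑ i ∈ Finset.Icc 1 n, X i ω)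
    (l a : ℝ) (hl : l = q / p)
    (ha : a = (1 / 2) * (Real.logb (q / p) ((1 - p) / (1 - q)) - 1)) :
    Martingale
      (fun k => fun ω => l ^ (S (k + 1) ω + a * X (k + 1) ω))
      (crwFiltration X hX.1) μ
    ∧ p * l + (1 - p) * l ^ (-1 - 2 * a) = 1
    ∧ (1 - q) * l ^ (1 + 2 * a) + q * l ^ (-1 : ℝ) = 1 := by
  have hsys := rpow_logb_ratio_system hp0 hp1 hq0 hq1 hpq hl ha
  refine ⟨?_, hsys⟩
  have hl0 : 0 < l := hl ▸ div_pos hq0 hp0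
  set r : ℝ → ℝ → ℝ := fun i j => l ^ ((1 + a) * j - a * i) with hr_def
  have hr : ∀ i ∈ ({1, -1} : Finset ℝ),
      ∑ j ∈ ({1, -1} : Finset ℝ), crwKernel p q i j * r i j = 1 := by
    have hne : (1 : ℝ) ≠ -1 := by norm_num
    intro i hi
    simp only [Finset.mem_insert, Finset.mem_singleton] at hi
    rw [Finset.sum_pair hne]
    rcases hi with rfl | rfl
    · refine Eq.trans ?_ hsys.1
      simp only [crwKernel, hr_def, if_true, if_neg hne.symm]
      rw [show (1 + a) * 1 - a * 1 = 1 by ring, Real.rpow_one,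
        show (1 + a) * -1 - a * 1 = -1 - 2 * a by ring]
    · refine Eq.trans ?_ hsys.2
      simp only [crwKernel, hr_def, if_true, if_neg hne, if_neg hne.symm]
      rw [show (1 + a) * 1 - a * -1 = 1 + 2 * a by ring,
        show (1 + a) * -1 - a * -1 = -1 by ring]
  set M : ℕ → Ω → ℝ := fun k ω => l ^ (S (k + 1) ω + a * X (k + 1) ω) with hM
  have hsucc : ∀ k, M (k + 1) = M k * stepFactor X r (k + 1) := by
    intro k
    ext ω
    rw [Pi.mul_apply, hX.stepFactor_eq r (by omega)]
    simp only [hM, hr_def]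
    rw [← Real.rpow_add hl0, hS, hS, Finset.sum_Icc_succ_top (by omega : 1 ≤ k + 1 + 1)]
    congr 1
    ring
  have hmeas : ∀ k, Measurable[sigmaUpTo X (k + 1)] (M k) := by
    intro k
    have hXm : ∀ i ∈ Finset.Icc 1 (k + 1), Measurable[sigmaUpTo X (k + 1)] (X i) := fun i hi =>
      measurable_sigmaUpTo (Finset.mem_Icc.1 hi).1 (Finset.mem_Icc.1 hi).2
    have hSm : Measurable[sigmaUpTo X (k + 1)] (S (k + 1)) := by
      rw [show S (k + 1) = fun ω => ∑ i ∈ Finset.Icc 1 (k + 1), X i ω from funext (hS _)]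
      exact Finset.measurable_fun_sum _ hXm
    exact measurable_const.pow
      (hSm.add (measurable_const.mul (hXm (k + 1) (by simp))))
  have hint : ∀ k, Integrable (M k) μ := by
    intro k
    induction k with
    | zero =>
      refine Integrable.of_bound ((hmeas 0).mono (sigmaUpTo_le hX.1 1) le_rfl).aestronglyMeasurable
        (l ^ (1 + a) + l ^ (-1 + a * -1)) (ae_of_all _ fun ω => ?_)
      have h1 := Real.rpow_pos_of_pos hl0 (1 + a)
      have h2 := Real.rpow_pos_of_pos hl0 (-1 + a * -1)
      have hM0 : M 0 ω = l ^ (X 1 ω + a * X 1 ω) := by simp [hM, hS]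
      rw [hM0, Real.norm_of_nonneg (Real.rpow_pos_of_pos hl0 _).le]
      rcases hX.2.1 1 le_rfl ω with h | h <;> rw [h]
      · rw [mul_one]
        linarith
      · linarith
    | succ k ih =>
      rw [hsucc]
      exact ih.mul_bdd (hX.integrable_stepFactor r (by omega)).aestronglyMeasurable
        (ae_of_all _ (norm_stepFactor_le X r (k + 1)))
  refine martingale_nat (fun k => (hmeas k).stronglyMeasurable) hint fun k => ?_
  have hone := hX.condExp_stepFactor hp0 hp1 hq0 hq1 hr (n := k + 1) (by omega)
  have hpull : μ[M (k + 1)|sigmaUpTo X (k + 1)] =ᵐ[μ]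
      M k * μ[stepFactor X r (k + 1)|sigmaUpTo X (k + 1)] := by
    rw [hsucc]
    exact condExp_mul_of_stronglyMeasurable_left (hmeas k).stronglyMeasurable
      (hsucc k ▸ hint (k + 1)) (hX.integrable_stepFactor r (by omega))
  change M k =ᵐ[μ] μ[M (k + 1)|sigmaUpTo X (k + 1)]
  filter_upwards [hone, hpull] with ω h1 h2
  rw [h2, Pi.mul_apply, ← h1, mul_one]
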